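/- arXiv:1205.0600 — 2 statements merged into one kernel-verified Lean document; each statement's English description precedes it below -/
import Mathlib

section
/- Let I = [0,1]. For every family 𝒢 of subsets of I × I of cardinality at most 𝔠 (the cardinality of the continuum), there exists a function f : I → I such that: (i) X^f ∉ 𝒢; (ii) the graph X^f = {(s, f(s)) : s ∈ I}, with the subspace topology inherited from I × I, is a dense connected subset of I × I; and (iii) X^f is a king space having exactly two continuous weak selections. -/
/-- A weak selection on `X`, encoded as a symmetric function `φ : X → X → X`
with `φ a b ∈ {a, b}` for all `a b`. -/
def IsWeakSelection {X : Type*} (φ : X → X → X) : Prop :=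
  (∀ a b : X, φ a b = φ b a) ∧ (∀ a b : X, φ a b = a ∨ φ a b = b)

/-- `a →_φ b` : either `a = b`, or `a ≠ b` and `φ {a,b} = b`. -/
def SelArrow {X : Type*} (φ : X → X → X) (a b : X) : Prop :=
  a = b ∨ (a ≠ b ∧ φ a b = b)

/-- `z` is a `φ`-king: for every `x` there is `y` with `z →_φ y →_φ x`. -/
def IsKing {X : Type*} (φ : X → X → X) (z : X) : Prop :=
  ∀ x : X, ∃ y : X, SelArrow φ z y ∧ SelArrow φ y x

/-- Continuity of a weak selection `φ` on a topological space `X`. -/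
def ContWeakSel {X : Type*} [TopologicalSpace X] (φ : X → X → X) : Prop :=
  ∀ a b : X, a ≠ b → ∀ W : Set X, IsOpen W → φ a b ∈ W →
    ∃ U V : Set X, IsOpen U ∧ IsOpen V ∧ a ∈ U ∧ b ∈ V ∧
      ∀ a' ∈ U, ∀ b' ∈ V, a' ≠ b' → φ a' b' ∈ W

/-- A king space: every continuous weak selection has a king. -/
def IsKingSpace (X : Type*) [TopologicalSpace X] : Prop :=
  ∀ φ : X → X → X, IsWeakSelection φ → ContWeakSel φ → ∃ z : X, IsKing φ z

open Set Cardinal Topology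

theorem mk_closeds_le_continuum (X : Type) [TopologicalSpace X] [SecondCountableTopology X] :
    #(TopologicalSpace.Closeds X) ≤ 𝔠 := by
  let B := TopologicalSpace.countableBasis X
  have hB := TopologicalSpace.isBasis_countableBasis X
  let F : TopologicalSpace.Closeds X → Set B := fun K => {s | (s : Set X) ⊆ (K : Set X)ᶜ}
  have hF : Function.Injective F := by
    intro K L h
    have key : ∀ K L : TopologicalSpace.Closeds X, F K = F L → (K : Set X)ᶜ ⊆ (L : Set X)ᶜ := by
      intro K L h x hx
      obtain ⟨s, hs, hxs, hsK⟩ := hB.exists_subset_of_mem_open hx K.isClosed.isOpen_compl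
      have : (⟨s, hs⟩ : B) ∈ F L := h ▸ hsK
      exact this hxs
    exact SetLike.coe_injective (compl_injective ((key K L h).antisymm (key L K h.symm)))
  calc #(TopologicalSpace.Closeds X) ≤ #(Set B) := mk_le_of_injective hF
    _ = 2 ^ #B := mk_set
    _ ≤ 2 ^ ℵ₀ := by
      apply power_le_power_left two_ne_zero
      exact mk_le_aleph0_iff.2 (TopologicalSpace.countable_countableBasis X)
    _ = 𝔠 := two_power_aleph0

/-- A family of at most `c` sets of cardinality at least `c` has an injective choice function. -/
theorem exists_injective_mem {ι X : Type} {c : Cardinal.{0}} (hι : #ι ≤ c) (S : ι → Set X)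
    (hS : ∀ i, c ≤ #(S i)) : ∃ x : ι → X, Function.Injective x ∧ ∀ i, x i ∈ S i := by
  obtain ⟨r, hr, hord⟩ := Cardinal.exists_ord_eq ι
  have hstep : ∀ (i : ι) (g : ∀ j, r j i → X), ∃ y ∈ S i, ∀ j (h : r j i), g j h ≠ y := by
    intro i g
    by_contra! hcon
    choose j hj hg using hcon
    have hinj : Function.Injective
        (fun y : S i => (⟨j y y.2, hj y y.2⟩ : {j // r j i})) := by
      intro y z h
      apply Subtype.ext
      rw [← hg y y.2, ← hg z z.2]
      have h' := congrArg Subtype.val h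
      dsimp only at h'
      congr
    have hlt : #{j // r j i} < #ι := card_typein_lt i hord
    exact ((hS i).trans (mk_le_of_injective hinj)).not_gt (hlt.trans_le hι)
  choose y hyS hyne using hstep
  let x : ι → X := hr.wf.fix fun i g => y i g
  have hx : ∀ i, x i = y i (fun j _ => x j) := fun i => hr.wf.fix_eq _ i
  have hne : ∀ i j, r j i → x j ≠ x i := fun i j h => by
    rw [hx i]
    exact hyne i (fun j _ => x j) j h
  refine ⟨x, fun i j hij => ?_, fun i => hx i ▸ hyS i _⟩
  rcases trichotomous_of r i j with h | h | h
  · exact absurd hij (hne _ _ h)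
  · exact h
  · exact absurd hij.symm (hne _ _ h)

theorem exists_function_agreeing {ι X Y : Type} [Nonempty Y] {c : Cardinal.{0}} (hι : #ι ≤ c)
    (S : ι → Set X) (hS : ∀ i, c ≤ #(S i)) (v : ι → X → Y) :
    ∃ f : X → Y, ∀ i, ∃ x ∈ S i, f x = v i x := by
  obtain ⟨x, hinj, hx⟩ := exists_injective_mem hι S hS
  exact ⟨Function.extend x (fun i => v i (x i)) fun _ => Classical.arbitrary Y,
    fun i => ⟨x i, hx i, hinj.extend_apply _ _ i⟩⟩

theorem continuum_le_mk_Icc_unitInterval {a b : unitInterval} (h : a < b) : 𝔠 ≤ #(Icc a b) := by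
  rw [← mk_Icc_real (show (a : ℝ) < b from h)]
  refine mk_le_of_injective (f := fun x : Icc (a : ℝ) b =>
    (⟨⟨x, a.2.1.trans x.2.1, x.2.2.trans b.2.2⟩, x.2.1, x.2.2⟩ : Icc a b)) fun x y hxy => ?_
  simpa [Subtype.ext_iff] using hxy

/-- The graph of `f` meets every closed set whose projection contains a nondegenerate interval. -/
def MeetsBlockingSets (f : unitInterval → unitInterval) : Prop :=
  ∀ a b : unitInterval, a < b → ∀ K : Set (unitInterval × unitInterval), IsClosed K →
    (∀ x ∈ Icc a b, ∃ y, (x, y) ∈ K) → ∃ x ∈ Icc a b, (x, f x) ∈ K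

theorem exists_meetsBlockingSets_avoiding (𝒢 : Set (Set (unitInterval × unitInterval)))
    (h𝒢 : #𝒢 ≤ 𝔠) :
    ∃ f : unitInterval → unitInterval, MeetsBlockingSets f ∧
      {p : unitInterval × unitInterval | p.2 = f p.1} ∉ 𝒢 := by
  classical
  let I := unitInterval
  let T := {t : (I × I) × TopologicalSpace.Closeds (I × I) // t.1.1 < t.1.2}
  have hI : #I = 𝔠 := by exact mk_Icc_real zero_lt_one
  have hT : #T ≤ 𝔠 := by
    refine (mk_subtype_le _).trans ?_
    simp only [mk_prod, lift_id, hI]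
    calc 𝔠 * 𝔠 * #(TopologicalSpace.Closeds (I × I)) ≤ 𝔠 * 𝔠 * 𝔠 := by
          gcongr; exact mk_closeds_le_continuum _
      _ = 𝔠 := by simp
  have hι : #(T ⊕ 𝒢) ≤ 𝔠 := by
    rw [mk_sum, lift_id, lift_id]
    calc #T + #𝒢 ≤ 𝔠 + 𝔠 := add_le_add hT h𝒢
      _ = 𝔠 := continuum_add_self
  let S : T ⊕ 𝒢 → Set I := Sum.elim (fun t => Icc t.1.1.1 t.1.1.2) (fun _ => univ)
  have hS : ∀ i, 𝔠 ≤ #(S i) := by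
    rintro (t | g)
    · exact continuum_le_mk_Icc_unitInterval t.2
    · exact (mk_univ.trans hI).ge
  let v : T ⊕ 𝒢 → I → I := Sum.elim
    (fun t x => if h : ∃ y, (x, y) ∈ t.1.2 then h.choose else 0)
    (fun g x => if (x, (0 : I)) ∈ g.1 then 1 else 0)
  obtain ⟨f, hf⟩ := exists_function_agreeing (Y := I) hι S hS v
  refine ⟨f, fun a b hab K hK hfull => ?_, fun hmem => ?_⟩
  · obtain ⟨x, hx, hfx⟩ := hf (Sum.inl ⟨((a, b), ⟨K, hK⟩), hab⟩)
    refine ⟨x, hx, ?_⟩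
    have h : ∃ y, (x, y) ∈ (⟨K, hK⟩ : TopologicalSpace.Closeds (I × I)) := hfull x hx
    rw [hfx]
    simp only [v, Sum.elim_inl, dif_pos h]
    exact h.choose_spec
  · obtain ⟨x, -, hfx⟩ := hf (Sum.inr ⟨_, hmem⟩)
    simp only [v, Sum.elim_inr] at hfx
    split_ifs at hfx with h
    · exact zero_ne_one (h.trans hfx)
    · exact h hfx.symm

theorem exists_Icc_subset_of_mem {J O : Set unitInterval} (hJ : J.OrdConnected)
    (hJn : J.Nontrivial) (hO : IsOpen O) {x : unitInterval} (hxJ : x ∈ J) (hxO : x ∈ O) :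
    ∃ a b, a < b ∧ Icc a b ⊆ J ∩ O := by
  obtain ⟨z, hzJ, hzx⟩ := hJn.exists_ne x
  rcases lt_or_gt_of_ne hzx with h | h
  · obtain ⟨l, hl, hlO⟩ := exists_Ioc_subset_of_mem_nhds (hO.mem_nhds hxO) ⟨z, h⟩
    obtain ⟨a, ha, hax⟩ := exists_between (max_lt hl h)
    refine ⟨a, x, hax, fun w hw => ⟨hJ.out hzJ hxJ ⟨?_, hw.2⟩, hlO ⟨?_, hw.2⟩⟩⟩
    · exact ((le_max_right _ _).trans_lt ha).le.trans hw.1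
    · exact ((le_max_left _ _).trans_lt ha).trans_le hw.1
  · obtain ⟨u, hu, huO⟩ := exists_Ico_subset_of_mem_nhds (hO.mem_nhds hxO) ⟨z, h⟩
    obtain ⟨b, hxb, hb⟩ := exists_between (lt_min hu h)
    refine ⟨x, b, hxb, fun w hw => ⟨hJ.out hxJ hzJ ⟨hw.1, ?_⟩, huO ⟨hw.1, ?_⟩⟩⟩
    · exact hw.2.trans (hb.trans_le (min_le_right _ _)).le
    · exact hw.2.trans_lt (hb.trans_le (min_le_left _ _))

namespace MeetsBlockingSets

variable {f : unitInterval → unitInterval}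

theorem exists_mem_of_isOpen (hf : MeetsBlockingSets f) {J : Set unitInterval}
    (hJ : J.OrdConnected) (hJn : J.Nontrivial) {W : Set (unitInterval × unitInterval)}
    (hW : IsOpen W) {p : unitInterval × unitInterval} (hpJ : p.1 ∈ J) (hp : p ∈ W) :
    ∃ x ∈ J, (x, f x) ∈ W := by
  obtain ⟨a, b, hab, hsub⟩ := exists_Icc_subset_of_mem hJ hJn
    (hW.preimage (f := fun x => (x, p.2)) (by fun_prop)) hpJ hp
  obtain ⟨x, hx, hxK⟩ := hf a b hab (Set.univ ×ˢ {p.2}) (isClosed_univ.prod isClosed_singleton)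
    fun x _ => ⟨p.2, by simp⟩
  have hfx : f x = p.2 := by simpa using hxK
  exact ⟨x, (hsub hx).1, by simpa [hfx] using (hsub hx).2⟩

theorem dense_graph (hf : MeetsBlockingSets f) :
    Dense {p : unitInterval × unitInterval | p.2 = f p.1} := by
  refine dense_iff_inter_open.2 fun W hW ⟨p, hp⟩ => ?_
  obtain ⟨x, -, hx⟩ := hf.exists_mem_of_isOpen ordConnected_univ nontrivial_univ hW (mem_univ _) hp
  exact ⟨_, hx, rfl⟩

theorem isPreconnected_image_graph (hf : MeetsBlockingSets f) {J : Set unitInterval}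
    (hJ : J.OrdConnected) : IsPreconnected ((fun x => (x, f x)) '' J) := by
  rcases J.subsingleton_or_nontrivial with hJs | hJn
  · exact (hJs.image _).isPreconnected
  rintro U V hU hV hcover ⟨-, ⟨u, huJ, rfl⟩, hu⟩ ⟨-, ⟨v, hvJ, rfl⟩, hv⟩
  suffices ∃ x ∈ J, (x, f x) ∈ U ∩ V from
    let ⟨x, hx, h⟩ := this
    ⟨_, mem_image_of_mem _ hx, h⟩
  have hU' : IsOpen (Prod.fst '' U) := isOpenMap_fst _ hU
  have hV' : IsOpen (Prod.fst '' V) := isOpenMap_fst _ hV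
  obtain ⟨x, hxJ, hx⟩ := hJ.isPreconnected _ _ hU' hV'
    (fun x hx => (hcover (mem_image_of_mem _ hx)).imp (mem_image_of_mem Prod.fst)
      (mem_image_of_mem Prod.fst))
    ⟨u, huJ, mem_image_of_mem Prod.fst hu⟩ ⟨v, hvJ, mem_image_of_mem Prod.fst hv⟩
  obtain ⟨a, b, hab, hsub⟩ := exists_Icc_subset_of_mem hJ hJn (hU'.inter hV') hxJ hx
  by_cases hfib : ∃ p ∈ U ∩ V, p.1 ∈ J
  · obtain ⟨p, hp, hpJ⟩ := hfib
    exact hf.exists_mem_of_isOpen hJ hJn (hU.inter hV) hpJ hp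
  obtain ⟨w, hw, hwK⟩ := hf a b hab (U ∪ V)ᶜ (hU.union hV).isClosed_compl fun w hw => by
    by_contra! hcon
    obtain ⟨hwJ, ⟨⟨w, y⟩, hy, rfl⟩, ⟨⟨w', z⟩, hz, rfl⟩⟩ := hsub hw
    obtain ⟨y', -, hy'⟩ := isPreconnected_univ (α := unitInterval)
      ((fun y => (w', y)) ⁻¹' U) ((fun y => (w', y)) ⁻¹' V)
      (hU.preimage (by fun_prop)) (hV.preimage (by fun_prop))
      (fun y _ => by simpa [or_iff_not_imp_left] using hcon y) ⟨y, trivial, hy⟩ ⟨z, trivial, hz⟩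
    exact hfib ⟨_, hy', hwJ⟩
  exact absurd (hcover (mem_image_of_mem _ (hsub hw).1)) hwK

end MeetsBlockingSets

section Selections

variable {X L : Type*} [LinearOrder L]

open Classical in
/-- The weak selection picking the point whose image under `π` is smaller. -/
noncomputable def minSelection (π : X → L) (a b : X) : X := if π a ≤ π b then a else b

theorem minSelection_of_lt {π : X → L} {a b : X} (h : π a < π b) : minSelection π a b = a :=
  if_pos h.le

theorem minSelection_of_gt {π : X → L} {a b : X} (h : π b < π a) : minSelection π a b = b :=
  if_neg h.not_ge

theorem minSelection_toDual_of_lt {π : X → L} {a b : X} (h : π a < π b) :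
    minSelection (OrderDual.toDual ∘ π) a b = b :=
  minSelection_of_gt (π := OrderDual.toDual ∘ π) (OrderDual.toDual_lt_toDual.2 h)

theorem minSelection_toDual_of_gt {π : X → L} {a b : X} (h : π b < π a) :
    minSelection (OrderDual.toDual ∘ π) a b = a :=
  minSelection_of_lt (π := OrderDual.toDual ∘ π) (OrderDual.toDual_lt_toDual.2 h)

theorem isWeakSelection_minSelection {π : X → L} (hπ : Function.Injective π) :
    IsWeakSelection (minSelection π) := by
  refine ⟨fun a b => ?_, fun a b => by unfold minSelection; split_ifs <;> simp⟩
  unfold minSelection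
  split_ifs with h h' h'
  · exact hπ (h.antisymm h')
  · rfl
  · rfl
  · exact absurd (le_total _ _) (not_or.2 ⟨h, h'⟩)

theorem isKing_minSelection {π : X → L} (hπ : Function.Injective π) {z : X}
    (hz : ∀ x, π x ≤ π z) : IsKing (minSelection π) z := by
  refine fun x => ⟨x, ?_, Or.inl rfl⟩
  rcases eq_or_ne z x with h | h
  · exact Or.inl h
  · exact Or.inr ⟨h, minSelection_of_gt ((hz x).lt_of_ne fun h' => h (hπ h').symm)⟩

variable [TopologicalSpace X]

theorem contWeakSel_minSelection [TopologicalSpace L] [OrderTopology L] {π : X → L}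
    (hπ : Function.Injective π) (hc : Continuous π) :
    ContWeakSel (minSelection π) := by
  intro a b hab W hW hmem
  rcases lt_or_gt_of_ne (hπ.ne hab) with h | h
  · rw [minSelection_of_lt h] at hmem
    obtain ⟨u, v, hu, hv, hau, hbv, huv⟩ := order_separated h
    refine ⟨π ⁻¹' u ∩ W, π ⁻¹' v, (hu.preimage hc).inter hW, hv.preimage hc, ⟨hau, hmem⟩, hbv,
      fun x hx y hy _ => ?_⟩
    rw [minSelection_of_lt (huv _ hx.1 _ hy)]
    exact hx.2
  · rw [minSelection_of_gt h] at hmem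
    obtain ⟨u, v, hu, hv, hbu, hav, huv⟩ := order_separated h
    refine ⟨π ⁻¹' v, π ⁻¹' u ∩ W, hv.preimage hc, (hu.preimage hc).inter hW, hav, ⟨hbu, hmem⟩,
      fun x hx y hy _ => ?_⟩
    rw [minSelection_of_gt (huv _ hy.1 _ hx)]
    exact hy.2

theorem isPreconnected_setOf_lt {π : X → L} (hlt : ∀ t, IsPreconnected {x | π x < π t})
    (hgt : ∀ t, IsPreconnected {x | π t < π x}) :
    IsPreconnected {p : X × X | π p.1 < π p.2} := by
  have key : ∀ p q : X × X, π p.1 < π p.2 → π q.1 < π q.2 → π p.2 ≤ π q.2 →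
      ∃ t ⊆ {p : X × X | π p.1 < π p.2}, p ∈ t ∧ q ∈ t ∧ IsPreconnected t := by
    rintro ⟨a, b⟩ ⟨c, d⟩ hp hq hpq
    refine ⟨Prod.mk a '' {x | π a < π x} ∪ (fun x => (x, d)) '' {x | π x < π d}, ?_,
      Or.inl ⟨b, hp, rfl⟩, Or.inr ⟨c, hq, rfl⟩, ?_⟩
    · rintro _ (⟨x, hx, rfl⟩ | ⟨x, hx, rfl⟩) <;> exact hx
    · have had : π a < π d := lt_of_lt_of_le hp hpq
      exact ((hgt a).image _ (by fun_prop)).union (a, d) ⟨d, had, rfl⟩ ⟨a, had, rfl⟩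
        ((hlt d).image _ (by fun_prop))
  refine isPreconnected_of_forall_pair fun p hp q hq => ?_
  rcases le_total (π p.2) (π q.2) with h | h
  · exact key p q hp hq h
  · obtain ⟨t, ht, hqt, hpt, hc⟩ := key q p hq hp h
    exact ⟨t, ht, hpt, hqt, hc⟩

theorem ContWeakSel.isOpen_setOf_eq_fst [T2Space X] {φ : X → X → X} (hφ : IsWeakSelection φ)
    (hc : ContWeakSel φ) : IsOpen {p : X × X | p.1 ≠ p.2 ∧ φ p.1 p.2 = p.1} := by
  refine isOpen_iff_mem_nhds.2 fun ⟨a, b⟩ ⟨hab, hfst⟩ => ?_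
  dsimp only at hab hfst
  obtain ⟨A, B, hA, hB, haA, hbB, hAB⟩ := t2_separation hab
  obtain ⟨U, V, hU, hV, haU, hbV, hUV⟩ := hc a b hab A hA (by rwa [hfst])
  filter_upwards [prod_mem_nhds ((hU.inter hA).mem_nhds ⟨haU, haA⟩)
    ((hV.inter hB).mem_nhds ⟨hbV, hbB⟩)] with p hp
  have hne : p.1 ≠ p.2 := hAB.ne_of_mem hp.1.2 hp.2.2
  refine ⟨hne, (hφ.2 _ _).resolve_right fun h => ?_⟩
  exact hAB.ne_of_mem (hUV _ hp.1.1 _ hp.2.1 hne) hp.2.2 h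

theorem ContWeakSel.eq_minSelection_or [T2Space X] {π : X → L} (hπ : Function.Injective π)
    (hlt : ∀ t, IsPreconnected {x | π x < π t}) (hgt : ∀ t, IsPreconnected {x | π t < π x})
    {φ : X → X → X} (hφ : IsWeakSelection φ) (hc : ContWeakSel φ) :
    φ = minSelection π ∨ φ = minSelection (OrderDual.toDual ∘ π) := by
  have hself : ∀ a, φ a a = a := fun a => (hφ.2 a a).elim id id
  have hfst := hc.isOpen_setOf_eq_fst hφ
  have hsnd : IsOpen {p : X × X | p.1 ≠ p.2 ∧ φ p.1 p.2 = p.2} := by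
    convert hfst.preimage continuous_swap using 1
    ext p
    simp [hφ.1 p.2 p.1, eq_comm (a := p.1)]
  have hdisj : Disjoint {p : X × X | p.1 ≠ p.2 ∧ φ p.1 p.2 = p.1}
      {p : X × X | p.1 ≠ p.2 ∧ φ p.1 p.2 = p.2} :=
    disjoint_left.2 fun p hp hp' => hp.1 (hp.2.symm.trans hp'.2)
  have hcover : {p : X × X | π p.1 < π p.2} ⊆ {p : X × X | p.1 ≠ p.2 ∧ φ p.1 p.2 = p.1} ∪
      {p : X × X | p.1 ≠ p.2 ∧ φ p.1 p.2 = p.2} := fun p hp => by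
    have hne : p.1 ≠ p.2 := fun h => hp.ne (congrArg π h)
    exact (hφ.2 p.1 p.2).imp (⟨hne, ·⟩) (⟨hne, ·⟩)
  refine ((isPreconnected_setOf_lt hlt hgt).subset_or_subset hfst hsnd hdisj hcover).imp
    (fun h => ?_) (fun h => ?_) <;> funext a b <;>
    rcases lt_trichotomy (π a) (π b) with hab | hab | hab
  · rw [minSelection_of_lt hab]
    exact (h (show (a, b) ∈ {p : X × X | π p.1 < π p.2} from hab)).2
  · rw [hπ hab, hself, minSelection, ite_self]
  · rw [minSelection_of_gt hab, hφ.1]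
    exact (h (show (b, a) ∈ {p : X × X | π p.1 < π p.2} from hab)).2
  · rw [minSelection_toDual_of_lt hab]
    exact (h (show (a, b) ∈ {p : X × X | π p.1 < π p.2} from hab)).2
  · rw [hπ hab, hself, minSelection, ite_self]
  · rw [minSelection_toDual_of_gt hab, hφ.1]
    exact (h (show (b, a) ∈ {p : X × X | π p.1 < π p.2} from hab)).2

end Selections

open unitInterval in
/-- For every family `𝒢` of at most continuum many subsets of `I × I` there is
`f : I → I` whose graph avoids `𝒢`, is dense and connected in `I × I`, and is
a king space with exactly two continuous weak selections. -/
theorem exists_connected_graph_king_avoiding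
    (𝒢 : Set (Set (unitInterval × unitInterval)))
    (h𝒢 : Cardinal.mk ↥𝒢 ≤ Cardinal.continuum) :
    ∃ f : unitInterval → unitInterval,
      ∀ Xf : Set (unitInterval × unitInterval),
        Xf = {p : unitInterval × unitInterval | p.2 = f p.1} →
        Xf ∉ 𝒢 ∧
        Dense Xf ∧ IsConnected Xf ∧
        IsKingSpace Xf ∧
        ∃ σ₁ σ₂ : Xf → Xf → Xf, σ₁ ≠ σ₂ ∧
          IsWeakSelection σ₁ ∧ ContWeakSel σ₁ ∧
          IsWeakSelection σ₂ ∧ ContWeakSel σ₂ ∧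
          ∀ φ : Xf → Xf → Xf, IsWeakSelection φ → ContWeakSel φ →
            φ = σ₁ ∨ φ = σ₂ := by
  obtain ⟨f, hf, hfG⟩ := exists_meetsBlockingSets_avoiding 𝒢 h𝒢
  refine ⟨f, ?_⟩
  rintro Xf rfl
  let Γ : Set (unitInterval × unitInterval) := {p | p.2 = f p.1}
  let π : Γ → unitInterval := fun p => p.1.1
  have hπc : Continuous π := by fun_prop
  have hπ : Function.Injective π := fun p q h =>
    Subtype.ext (Prod.ext h (p.2.trans ((congrArg f h).trans q.2.symm)))
  let pt : unitInterval → Γ := fun x => ⟨(x, f x), rfl⟩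
  have hpre : ∀ J : Set unitInterval, J.OrdConnected → IsPreconnected (π ⁻¹' J) := fun J hJ => by
    rw [← Topology.IsInducing.subtypeVal.isPreconnected_image]
    convert hf.isPreconnected_image_graph hJ using 1
    ext p
    constructor
    · rintro ⟨q, hq, rfl⟩
      exact ⟨q.1.1, hq, Prod.ext rfl q.2.symm⟩
    · rintro ⟨x, hx, rfl⟩
      exact ⟨pt x, hx, rfl⟩
  have hclass : ∀ φ : Γ → Γ → Γ, IsWeakSelection φ → ContWeakSel φ →
      φ = minSelection π ∨ φ = minSelection (OrderDual.toDual ∘ π) := fun φ hφ hc =>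
    hc.eq_minSelection_or hπ (fun t => hpre (Iio (π t)) ordConnected_Iio)
      (fun t => hpre (Ioi (π t)) ordConnected_Ioi) hφ
  have hπd : Function.Injective (OrderDual.toDual ∘ π) := OrderDual.toDual.injective.comp hπ
  refine ⟨hfG, hf.dense_graph, ⟨⟨(0, f 0), rfl⟩, ?_⟩, fun φ hφ hc => ?_,
    minSelection π, minSelection (OrderDual.toDual ∘ π), fun h => ?_,
    isWeakSelection_minSelection hπ, contWeakSel_minSelection hπ hπc,
    isWeakSelection_minSelection hπd, contWeakSel_minSelection hπd (continuous_toDual.comp hπc),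
    hclass⟩
  · have h := hpre Set.univ ordConnected_univ
    rw [preimage_univ] at h
    exact isPreconnected_iff_preconnectedSpace.2 ⟨h⟩
  · rcases hclass φ hφ hc with rfl | rfl
    · exact ⟨pt 1, isKing_minSelection hπ fun x => unitInterval.le_one _⟩
    · exact ⟨pt 0, isKing_minSelection hπd fun x => unitInterval.nonneg (π x)⟩
  · have h01 := congrArg π (congrFun (congrFun h (pt 0)) (pt 1))
    have hlt : π (pt 0) < π (pt 1) := zero_lt_one
    rw [minSelection_of_lt hlt, minSelection_toDual_of_lt hlt] at h01
    exact zero_ne_one h01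
end

section
/- Let I = [0,1]. There exists a function f : I → I such that the graph X^f = {(s, f(s)) : s ∈ I}, with the subspace topology inherited from I × I, is a connected dense subset of I × I and a king space, yet X^f is not an analytic subset of I × I (and in particular X^f is not completely metrizable). -/
open Set Cardinal in
/-- A family of `κ` many sets, each of size at least `κ`, has an injective choice function. -/
theorem exists_injective_forall_mem_of_mk_le {ι α : Type} (S : ι → Set α)
    (hS : ∀ i, #ι ≤ #(S i)) : ∃ g : ι → α, Function.Injective g ∧ ∀ i, g i ∈ S i := by
  obtain ⟨r, hr, hord⟩ := Cardinal.exists_ord_eq ι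
  have hex : ∀ (i : ι) (h : ∀ j, r j i → α), ∃ x ∈ S i, ∀ j (hj : r j i), h j hj ≠ x := by
    intro i h
    by_contra! hcon
    have hsub : S i ⊆ range (fun j : {j // r j i} => h j.1 j.2) := by
      intro x hx
      obtain ⟨j, hj, e⟩ := hcon x hx
      exact ⟨⟨j, hj⟩, e⟩
    have hlt : #{j // r j i} < #ι := by
      rw [← Ordinal.card_typein]
      exact card_typein_lt i hord
    exact absurd ((hS i).trans ((mk_le_mk_of_subset hsub).trans mk_range_le)) (not_le.2 hlt)
  have hwf : WellFounded r := hr.wf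
  let g : ι → α := hwf.fix fun i h => (hex i h).choose
  have hg : ∀ i, g i ∈ S i ∧ ∀ j, r j i → g j ≠ g i := by
    intro i
    have he : g i = (hex i fun j _ => g j).choose := hwf.fix_eq _ i
    rw [he]
    exact (hex i fun j _ => g j).choose_spec
  refine ⟨g, fun i j hij => ?_, fun i => (hg i).1⟩
  rcases trichotomous_of r i j with h | h | h
  · exact absurd hij ((hg j).2 i h)
  · exact h
  · exact absurd hij.symm ((hg i).2 j h)

open Set Cardinal TopologicalSpace in
theorem mk_isClosed_le_continuum (X : Type) [TopologicalSpace X] [SecondCountableTopology X] :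
    #{K : Set X | IsClosed K} ≤ 𝔠 := by
  have hb := isBasis_countableBasis X
  have hle : #(countableBasis X) ≤ 𝔠 :=
    ((countable_countableBasis X).le_aleph0).trans aleph0_le_continuum
  refine le_trans (mk_le_mk_of_subset ?_)
    (MeasurableSpace.cardinal_measurableSet_le_continuum hle)
  intro K hK
  have h : @MeasurableSet X (borel X) K := by
    borelize X
    exact hK.measurableSet
  rw [hb.borel_eq_generateFrom] at h
  exact h

open Set Cardinal in
theorem IsClosed.continuum_le_mk_of_not_countable {X : Type} [TopologicalSpace X] [PolishSpace X]
    {C : Set X} (hC : IsClosed C) (hunc : ¬ C.Countable) : 𝔠 ≤ #C := by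
  obtain ⟨e, hr, -, hinj⟩ := hC.exists_nat_bool_injection_of_not_countable hunc
  have h : #(ℕ → Bool) ≤ #C := mk_le_of_injective (f := fun x => (⟨e x, hr ⟨x, rfl⟩⟩ : C))
    fun x y hxy => hinj (Subtype.ext_iff.1 hxy)
  simpa using h

open Set in
/-- The graph of `f` meets every closed subset of the square with uncountable projection. -/
def MeetsUncountableClosed (f : unitInterval → unitInterval) : Prop :=
  ∀ K : Set (unitInterval × unitInterval), IsClosed K → ¬ (Prod.fst '' K).Countable →
    ∃ x, (x, f x) ∈ K

open Set Cardinal in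
theorem exists_meetsUncountableClosed : ∃ f, MeetsUncountableClosed f := by
  let ι := {K : Set (unitInterval × unitInterval) // IsClosed K ∧ ¬ (Prod.fst '' K).Countable}
  have hι : #ι ≤ 𝔠 :=
    (mk_subtype_mono fun K (h : IsClosed K ∧ _) => h.1).trans (mk_isClosed_le_continuum _)
  obtain ⟨g, hginj, hg⟩ := exists_injective_forall_mem_of_mk_le
    (fun K : ι => Prod.fst '' K.1) fun K => hι.trans <|
      IsClosed.continuum_le_mk_of_not_countable
        (K.2.1.isCompact.image continuous_fst).isClosed K.2.2
  choose p hpK hpg using hg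
  refine ⟨Function.extend g (fun K => (p K).2) (fun _ => 0), fun K hK hunc => ?_⟩
  refine ⟨g ⟨K, hK, hunc⟩, ?_⟩
  rw [hginj.extend_apply, ← hpg]
  exact hpK ⟨K, hK, hunc⟩

theorem not_countable_of_isOpen_unitInterval {U : Set unitInterval} (hU : IsOpen U)
    (hne : U.Nonempty) : ¬ U.Countable := by
  intro hc
  obtain ⟨a, b, hab, hs⟩ := hU.exists_Ioo_subset hne
  have h := (hc.mono hs).measure_zero MeasureTheory.volume
  rw [unitInterval.volume_Ioo, ENNReal.ofReal_eq_zero, sub_nonpos] at h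
  exact absurd hab (not_lt.2 h)

namespace MeetsUncountableClosed

open Set

variable {f : unitInterval → unitInterval}

theorem exists_mem_isOpen (hf : MeetsUncountableClosed f)
    {W : Set (unitInterval × unitInterval)} (hW : IsOpen W) (hne : W.Nonempty) :
    ∃ x, (x, f x) ∈ W := by
  obtain ⟨p, hp⟩ := hne
  obtain ⟨K, hK, hKc, hKW⟩ := exists_mem_nhds_isClosed_subset (hW.mem_nhds hp)
  obtain ⟨x, hx⟩ := hf K hKc fun hc =>
    not_countable_of_isOpen_unitInterval (isOpenMap_fst _ isOpen_interior)
      ⟨p.1, p, mem_interior_iff_mem_nhds.2 hK, rfl⟩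
      (hc.mono (image_mono interior_subset))
  exact ⟨x, hKW hx⟩

theorem isPreconnected_image_graph (hf : MeetsUncountableClosed f) {J : Set unitInterval}
    (hJo : IsOpen J) (hJ : IsPreconnected J) :
    IsPreconnected ((fun x => (x, f x)) '' J) := by
  rintro U V hU hV hUV ⟨_, ⟨a, haJ, rfl⟩, haU⟩ ⟨_, ⟨b, hbJ, rfl⟩, hbV⟩
  by_contra hemp
  have hcov : ∀ x ∈ J, (x, f x) ∈ U ∨ (x, f x) ∈ V := fun x hx => hUV ⟨x, hx, rfl⟩
  have hdisj : ∀ x ∈ J, ∀ y, (x, y) ∈ U → (x, y) ∈ V → False := by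
    intro x hx y hxU hxV
    obtain ⟨z, ⟨hzU, hzV⟩, hzJ⟩ := hf.exists_mem_isOpen
      ((hU.inter hV).inter (hJo.preimage continuous_fst)) ⟨(x, y), ⟨hxU, hxV⟩, hx⟩
    exact hemp ⟨_, ⟨z, hzJ, rfl⟩, hzU, hzV⟩
  set D : Set unitInterval := {x ∈ J | ∃ y, (x, y) ∉ U ∪ V} with hD
  have hDc : D.Countable := by
    obtain ⟨F, hFc, hFJ, hFU, -⟩ := hJo.exists_iUnion_isClosed
    have hsub : D ⊆ ⋃ n, Prod.fst '' ((U ∪ V)ᶜ ∩ Prod.fst ⁻¹' F n) := by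
      rintro x ⟨hxJ, y, hy⟩
      rw [← hFU] at hxJ
      obtain ⟨n, hn⟩ := mem_iUnion.1 hxJ
      exact mem_iUnion.2 ⟨n, (x, y), ⟨hy, hn⟩, rfl⟩
    refine (countable_iUnion fun n => ?_).mono hsub
    by_contra hunc
    obtain ⟨x, hx, hxF⟩ := hf _
      ((hU.union hV).isClosed_compl.inter ((hFc n).preimage continuous_fst)) hunc
    exact hx (hcov x (hFJ n hxF))
  have hfib : ∀ x ∈ J, x ∉ D → (∀ y, (x, y) ∈ U) ∨ ∀ y, (x, y) ∈ V := by
    intro x hxJ hxD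
    have hcovx : ∀ y, (x, y) ∈ U ∨ (x, y) ∈ V := by
      intro y
      by_contra hy
      exact hxD ⟨hxJ, y, hy⟩
    by_contra! hcon
    obtain ⟨⟨y, hy⟩, z, hz⟩ := hcon
    obtain ⟨w, -, hwU, hwV⟩ := isPreconnected_univ (α := unitInterval)
      _ _ (hU.preimage (Continuous.prodMk_right x)) (hV.preimage (Continuous.prodMk_right x))
      (fun y _ => hcovx y) ⟨z, trivial, (hcovx z).resolve_right hz⟩
      ⟨y, trivial, (hcovx y).resolve_left hy⟩
    exact hdisj x hxJ w hwU hwV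
  have hnbhd : ∀ W : Set (unitInterval × unitInterval), IsOpen W → ∀ x ∈ J, (x, f x) ∈ W →
      ∃ N, IsOpen N ∧ x ∈ N ∧ N ⊆ J ∧ ∀ z ∈ N, ∃ y, (z, y) ∈ W := by
    intro W hW x hxJ hxW
    refine ⟨J ∩ (fun z => (z, f x)) ⁻¹' W, hJo.inter (hW.preimage (Continuous.prodMk_left _)),
      ⟨hxJ, hxW⟩, inter_subset_left, fun z hz => ⟨f x, hz.2⟩⟩
  have hopen : ∀ W W' : Set (unitInterval × unitInterval), IsOpen W → IsOpen W' →
      (∀ x ∈ J, (x, f x) ∈ W ∨ (x, f x) ∈ W') →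
      (∀ x ∈ J, ∀ y, (x, y) ∈ W → (x, y) ∈ W' → False) →
      (∀ x ∈ J, x ∉ D → (∀ y, (x, y) ∈ W) ∨ ∀ y, (x, y) ∈ W') →
      IsOpen {x ∈ J | (x, f x) ∈ W} := by
    intro W W' hW hW' hcov hdisj hfib
    refine isOpen_iff_forall_mem_open.2 fun x hx => ?_
    obtain ⟨N, hN, hxN, hNJ, hNW⟩ := hnbhd W hW x hx.1 hx.2
    refine ⟨N, fun t ht => ⟨hNJ ht, (hcov t (hNJ ht)).resolve_right fun htW' => ?_⟩, hN, hxN⟩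
    obtain ⟨M, hM, htM, hMJ, hMW'⟩ := hnbhd W' hW' t (hNJ ht) htW'
    obtain ⟨z, ⟨hzN, hzM⟩, hzD⟩ := not_subset.1 fun hs : N ∩ M ⊆ D =>
      not_countable_of_isOpen_unitInterval (hN.inter hM) ⟨t, ht, htM⟩ (hDc.mono hs)
    obtain ⟨y, hy⟩ := hNW z hzN
    obtain ⟨y', hy'⟩ := hMW' z hzM
    rcases hfib z (hMJ hzM) hzD with h | h
    · exact hdisj z (hMJ hzM) y' (h y') hy'
    · exact hdisj z (hMJ hzM) y hy (h y)
  have hA := hopen U V hU hV hcov hdisj hfib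
  have hB := hopen V U hV hU (fun x hx => (hcov x hx).symm)
    (fun x hx y h h' => hdisj x hx y h' h) fun x hx hxD => (hfib x hx hxD).symm
  obtain ⟨z, hzJ, hzA, hzB⟩ := hJ _ _ hA hB
    (fun x hx => (hcov x hx).imp (⟨hx, ·⟩) (⟨hx, ·⟩)) ⟨a, haJ, haJ, haU⟩ ⟨b, hbJ, hbJ, hbV⟩
  exact hdisj z hzJ _ hzA.2 hzB.2

theorem not_measurableSet_preimage_zero (hf : MeetsUncountableClosed f) :
    ¬ MeasurableSet {x | f x = 0} := by
  intro hm
  have key : ∀ A : Set unitInterval, MeasurableSet A → ∀ c, (∀ x ∈ A, f x ≠ c) →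
      MeasureTheory.volume A = 0 := by
    intro A hA c hc
    by_contra hpos
    obtain ⟨K, hKA, hK, hKpos⟩ := hA.exists_lt_isCompact (pos_iff_ne_zero.2 hpos)
    obtain ⟨x, hxK, hxc⟩ := hf (K ×ˢ {c}) (hK.isClosed.prod isClosed_singleton) (by
      rw [fst_image_prod _ (singleton_nonempty c)]
      exact fun h => hKpos.ne' (h.measure_zero _))
    exact hc x (hKA hxK) hxc
  have h0 := key _ hm 1 fun x (hx : f x = 0) => by rw [hx]; exact zero_ne_one
  have h1 := key _ hm.compl 0 fun x hx => hx
  have := MeasureTheory.prob_compl_eq_zero_iff (μ := MeasureTheory.volume) hm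
  rw [h0] at this
  exact zero_ne_one (this.1 h1)

theorem not_analyticSet_graph (hf : MeetsUncountableClosed f) :
    ¬ MeasureTheory.AnalyticSet {p : unitInterval × unitInterval | p.2 = f p.1} := by
  intro h
  have key : ∀ B : Set unitInterval, MeasurableSet B →
      MeasureTheory.AnalyticSet (f ⁻¹' B) := by
    intro B hB
    have he : f ⁻¹' B = Prod.fst '' ({p : unitInterval × unitInterval | p.2 = f p.1} ∩
        Prod.snd ⁻¹' B) := by
      ext x
      constructor
      · exact fun hx => ⟨(x, f x), ⟨rfl, hx⟩, rfl⟩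
      · rintro ⟨p, ⟨hp, hy⟩, rfl⟩
        rw [mem_preimage, ← show p.2 = f p.1 from hp]
        exact hy
    rw [he]
    refine MeasureTheory.AnalyticSet.image_of_continuous ?_ continuous_fst
    rw [inter_eq_iInter]
    refine MeasureTheory.AnalyticSet.iInter fun b => ?_
    cases b
    · exact (measurable_snd hB).analyticSet
    · exact h
  exact hf.not_measurableSet_preimage_zero
    ((key {0} (measurableSet_singleton 0)).measurableSet_of_compl
      (key {0}ᶜ (measurableSet_singleton 0).compl))

end MeetsUncountableClosed

open Set in
/-- On a preconnected set not containing `b`, the selection against `b` is constant. -/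
theorem IsPreconnected.weakSelection_dichotomy {X : Type*} [TopologicalSpace X] [T2Space X]
    {φ : X → X → X} (hφ : IsWeakSelection φ) (hc : ContWeakSel φ) {S : Set X}
    (hS : IsPreconnected S) {b : X} (hb : b ∉ S) :
    (∀ a ∈ S, φ a b = a) ∨ ∀ a ∈ S, φ a b = b := by
  have hA : IsOpen {a | a ≠ b ∧ φ a b = a} := by
    refine isOpen_iff_forall_mem_open.2 fun a ⟨hab, ha⟩ => ?_
    obtain ⟨O, P, hO, hP, haO, hbP, hOP⟩ := t2_separation hab
    obtain ⟨U, V, hU, -, haU, hbV, h⟩ := hc a b hab O hO (by rwa [ha])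
    refine ⟨U ∩ O, fun x hx => ?_, hU.inter hO, haU, haO⟩
    have hxb : x ≠ b := fun e => disjoint_left.1 hOP hx.2 (e ▸ hbP)
    refine ⟨hxb, (hφ.2 x b).resolve_right fun e => ?_⟩
    exact disjoint_left.1 hOP (e ▸ h x hx.1 b hbV hxb) hbP
  have hB : IsOpen {a | a ≠ b ∧ φ a b = b} := by
    refine isOpen_iff_forall_mem_open.2 fun a ⟨hab, ha⟩ => ?_
    obtain ⟨O, P, hO, hP, haO, hbP, hOP⟩ := t2_separation hab
    obtain ⟨U, V, hU, -, haU, hbV, h⟩ := hc a b hab P hP (by rwa [ha])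
    refine ⟨U ∩ O, fun x hx => ?_, hU.inter hO, haU, haO⟩
    have hxb : x ≠ b := fun e => disjoint_left.1 hOP hx.2 (e ▸ hbP)
    refine ⟨hxb, (hφ.2 x b).resolve_left fun e => ?_⟩
    have hxP := h x hx.1 b hbV hxb
    rw [e] at hxP
    exact disjoint_left.1 hOP hx.2 hxP
  by_contra! hcon
  obtain ⟨⟨x, hxS, hx⟩, y, hyS, hy⟩ := hcon
  have hne : ∀ a ∈ S, a ≠ b := fun a ha e => hb (e ▸ ha)
  obtain ⟨z, -, ⟨hzb, hz⟩, -, hz'⟩ := hS _ _ hA hB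
    (fun a ha => (hφ.2 a b).imp (⟨hne a ha, ·⟩) (⟨hne a ha, ·⟩))
    ⟨y, hyS, hne y hyS, (hφ.2 y b).resolve_right hy⟩
    ⟨x, hxS, hne x hxS, (hφ.2 x b).resolve_left hx⟩
  exact hzb (hz.symm.trans hz')

open Set in
/-- A space with an injection onto a bounded linear order whose initial and final open segments
have preconnected preimages is a king space. -/
theorem isKingSpace_of_isPreconnected_preimage {X L : Type*} [TopologicalSpace X] [T2Space X]
    [LinearOrder L] [BoundedOrder L] (e : X ≃ L)
    (hlt : ∀ t, IsPreconnected (e ⁻¹' Iio t)) (hgt : ∀ t, IsPreconnected (e ⁻¹' Ioi t)) :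
    IsKingSpace X := by
  intro φ hφ hc
  set z := e.symm ⊥ with hz
  have hez : e z = ⊥ := e.apply_symm_apply ⊥
  have hpos : ∀ x, x ≠ z → ⊥ < e x := fun x hx =>
    bot_lt_iff_ne_bot.2 fun h => hx (e.injective (h.trans hez.symm))
  have hlow : ∀ b, (∀ a ∈ e ⁻¹' Iio (e b), φ a b = a) ∨ ∀ a ∈ e ⁻¹' Iio (e b), φ a b = b :=
    fun b => (hlt (e b)).weakSelection_dichotomy hφ hc fun h => lt_irrefl _ h
  rcases (hgt ⊥).weakSelection_dichotomy hφ hc (b := z) (fun h => lt_irrefl _ (hez ▸ h : ⊥ < (⊥ : L)))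
    with h | h
  · refine ⟨z, fun x => ⟨x, ?_, Or.inl rfl⟩⟩
    by_cases hx : x = z
    · exact Or.inl hx.symm
    · exact Or.inr ⟨Ne.symm hx, by rw [hφ.1]; exact h x (hpos x hx)⟩
  · have hmin : ∀ a b, e a < e b → φ a b = a := by
      intro a b hab
      refine (hlow b).elim (fun h' => h' a hab) fun h' => ?_
      have hbz : b ≠ z := fun hb => not_lt_bot ((hb ▸ hez : e b = ⊥) ▸ hab)
      have hzb : φ z b = b := h' z (by simpa [hez] using hpos b hbz)
      exact absurd (hzb.symm.trans ((hφ.1 z b).trans (h b (hpos b hbz)))) hbz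
    refine ⟨e.symm ⊤, fun x => ⟨x, ?_, Or.inl rfl⟩⟩
    by_cases hx : x = e.symm ⊤
    · exact Or.inl hx.symm
    · refine Or.inr ⟨Ne.symm hx, ?_⟩
      rw [hφ.1]
      refine hmin _ _ ?_
      rw [e.apply_symm_apply]
      exact lt_top_iff_ne_top.2 fun h => hx (e.eq_symm_apply.2 h)

/-- The projection of a graph onto its domain. -/
def graphEquiv {α β : Type*} (f : α → β) : {p : α × β | p.2 = f p.1} ≃ α where
  toFun p := p.1.1
  invFun x := ⟨(x, f x), rfl⟩
  left_inv p := Subtype.ext (Prod.ext rfl p.2.symm)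
  right_inv _ := rfl

theorem image_val_preimage_graphEquiv {α β : Type*} (f : α → β) (J : Set α) :
    Subtype.val '' (graphEquiv f ⁻¹' J) = (fun x => (x, f x)) '' J := by
  ext q
  constructor
  · rintro ⟨p, hp, rfl⟩
    exact ⟨p.1.1, hp, Prod.ext rfl p.2.symm⟩
  · rintro ⟨x, hx, rfl⟩
    exact ⟨⟨(x, f x), rfl⟩, hx, rfl⟩

theorem MeasureTheory.AnalyticSet.of_exists_completeSpace {X : Type*} [TopologicalSpace X]
    [SecondCountableTopology X] {s : Set X}
    (h : ∃ m : MetricSpace s,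
      (@UniformSpace.toTopologicalSpace _ m.toUniformSpace =
        (inferInstance : TopologicalSpace s)) ∧ @CompleteSpace _ m.toUniformSpace) :
    MeasureTheory.AnalyticSet s := by
  obtain ⟨m, hm, hc⟩ := h
  have : PolishSpace s :=
    { toSecondCountableTopology := inferInstance
      complete := ⟨m, hm, hc⟩ }
  simpa using analyticSet_range_of_polishSpace (continuous_subtype_val : Continuous
    (Subtype.val : s → X))

open unitInterval in
/-- There is `f : I → I` whose graph is a connected dense subset of `I × I`
and a king space, yet is not an analytic subset of `I × I` (in particular, it
is not completely metrizable). -/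
theorem exists_non_analytic_king_graph :
    ∃ f : unitInterval → unitInterval,
      ∀ Xf : Set (unitInterval × unitInterval),
        Xf = {p : unitInterval × unitInterval | p.2 = f p.1} →
        Dense Xf ∧ IsConnected Xf ∧ IsKingSpace Xf ∧
        ¬ MeasureTheory.AnalyticSet Xf ∧
        ¬ ∃ m : MetricSpace Xf,
            (@UniformSpace.toTopologicalSpace _ m.toUniformSpace =
              (inferInstance : TopologicalSpace Xf)) ∧
            @CompleteSpace _ m.toUniformSpace := by
  obtain ⟨f, hf⟩ := exists_meetsUncountableClosed
  refine ⟨f, ?_⟩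
  rintro _ rfl
  have hpre : ∀ J : Set unitInterval, IsOpen J → IsPreconnected J →
      IsPreconnected (graphEquiv f ⁻¹' J) := by
    intro J hJo hJ
    rw [← Topology.IsInducing.subtypeVal.isPreconnected_image, image_val_preimage_graphEquiv]
    exact hf.isPreconnected_image_graph hJo hJ
  refine ⟨?_, ⟨⟨(0, f 0), rfl⟩, ?_⟩, ?_, hf.not_analyticSet_graph,
    fun h => hf.not_analyticSet_graph (.of_exists_completeSpace h)⟩
  · refine dense_iff_inter_open.2 fun W hW hne => ?_
    obtain ⟨x, hx⟩ := hf.exists_mem_isOpen hW hne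
    exact ⟨(x, f x), hx, rfl⟩
  · rw [isPreconnected_iff_preconnectedSpace]
    exact ⟨hpre Set.univ isOpen_univ isPreconnected_univ⟩
  · exact isKingSpace_of_isPreconnected_preimage (graphEquiv f)
      (fun t => hpre _ isOpen_Iio isPreconnected_Iio)
      (fun t => hpre _ isOpen_Ioi isPreconnected_Ioi)
end
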